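/- arXiv:1304.3886 — 2 statements merged into one kernel-verified Lean document; each statement's English description precedes it below -/
import Mathlib

section
/- (Novel CRB-type bound.) Consider the SLGM and assume every set of at most S columns of H is linearly independent (spark(H) > S). Let x₀ ∈ X_S and let K ⊆ {1,…,N} be nonempty with |K| ≤ S, so that H_Kᵀ H_K is invertible. Define the orthogonal projection matrix P = H_K (H_Kᵀ H_K)^{−1} H_Kᵀ ∈ ℝ^{M×M} and the vector x̃₀ ∈ ℝ^N whose entries indexed by K are given by (H_Kᵀ H_K)^{−1} H_Kᵀ (H x₀) and whose other entries are 0 (so x̃₀ ∈ X_S, supp(x̃₀) ⊆ K, and H x̃₀ = P H x₀). Let ĝ : ℝ^M → ℝ be Borel measurable, P_x-integrable for every x ∈ X_S, with ∫ ĝ² dP_{x₀} < ∞; write γ(x) = ∫ ĝ dP_x for x ∈ X_S. Suppose that for each l ∈ K the map t ↦ γ(x̃₀ + t e_l) is differentiable at t = 0, with derivative b_l; set b = (b_l)_{l∈K} ∈ ℝ^K. Then v(ĝ; x₀) ≥ exp(−‖(I − P) H x₀‖₂²/σ²) · [σ² · bᵀ (H_Kᵀ H_K)^{−1} b + γ(x̃₀)²]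 − γ(x₀)². -/
open Matrix MeasureTheory ProbabilityTheory

/-- The distribution `P_x` of `y = Hx + n` where `n` has i.i.d. `N(0,σ²)` entries. -/
noncomputable def slgmP {M N : ℕ} (H : Matrix (Fin M) (Fin N) ℝ) (σ : ℝ)
    (x : Fin N → ℝ) : Measure (Fin M → ℝ) :=
  Measure.map (fun n => H.mulVec x + n)
    (Measure.pi fun _ : Fin M => gaussianReal 0 ((σ ^ 2).toNNReal))

/-- The set `X_S` of `S`-sparse parameter vectors. -/
def sparseSet (N S : ℕ) : Set (Fin N → ℝ) := {x | (Function.support x).ncard ≤ S}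

/-- Mean function `γ_ĝ(x) = ∫ ĝ dP_x` of an estimator. -/
noncomputable def slgmMean {M N : ℕ} (H : Matrix (Fin M) (Fin N) ℝ) (σ : ℝ)
    (g : (Fin M → ℝ) → ℝ) (x : Fin N → ℝ) : ℝ := ∫ y, g y ∂ slgmP H σ x

/-- Variance `v(ĝ;x) = ∫ (ĝ(y) − γ_ĝ(x))² dP_x(y)` of an estimator. -/
noncomputable def slgmVar {M N : ℕ} (H : Matrix (Fin M) (Fin N) ℝ) (σ : ℝ)
    (g : (Fin M → ℝ) → ℝ) (x : Fin N → ℝ) : ℝ :=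
  ∫ y, (g y - slgmMean H σ g x) ^ 2 ∂ slgmP H σ x

/-- The submatrix `H_K` of the columns of `H` indexed by `K`. -/
def Hsub {M N : ℕ} (H : Matrix (Fin M) (Fin N) ℝ) (K : Finset (Fin N)) :
    Matrix (Fin M) ↥K ℝ := Matrix.of fun m k => H m k.1

/-- The Gram matrix `H_Kᵀ H_K`. -/
noncomputable def gramK {M N : ℕ} (H : Matrix (Fin M) (Fin N) ℝ) (K : Finset (Fin N)) :
    Matrix ↥K ↥K ℝ := (Hsub H K)ᵀ * Hsub H K

/-- The orthogonal projection matrix `P = H_K (H_Kᵀ H_K)⁻¹ H_Kᵀ`. -/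
noncomputable def projK {M N : ℕ} (H : Matrix (Fin M) (Fin N) ℝ) (K : Finset (Fin N)) :
    Matrix (Fin M) (Fin M) ℝ := Hsub H K * (gramK H K)⁻¹ * (Hsub H K)ᵀ

/-- The vector `x̃₀`: entries indexed by `K` equal `(H_Kᵀ H_K)⁻¹ H_Kᵀ (H x₀)`, other
entries are `0`; so `supp(x̃₀) ⊆ K` and `H x̃₀ = P H x₀`. -/
noncomputable def xtilde {M N : ℕ} (H : Matrix (Fin M) (Fin N) ℝ) (K : Finset (Fin N))
    (x₀ : Fin N → ℝ) : Fin N → ℝ :=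
  fun l => if h : l ∈ K then
    ((gramK H K)⁻¹ * (Hsub H K)ᵀ).mulVec (H.mulVec x₀) ⟨l, h⟩ else 0

open scoped NNReal ENNReal

/-- The likelihood ratio of `N(d, v I)` with respect to `N(0, v I)`. -/
noncomputable def gaussLR {ι : Type*} [Fintype ι] (v : ℝ) (d z : ι → ℝ) : ℝ :=
  Real.exp (d ⬝ᵥ z / v - d ⬝ᵥ d / (2 * v))

lemma gaussianReal_eq_withDensity_zero (d : ℝ) {v : ℝ≥0} (hv : v ≠ 0) :
    gaussianReal d v = (gaussianReal 0 v).withDensity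
      fun x => ENNReal.ofReal (Real.exp (d * x / v - d * d / (2 * v))) := by
  rw [gaussianReal_of_var_ne_zero _ hv, gaussianReal_of_var_ne_zero _ hv,
    ← withDensity_mul _ (measurable_gaussianPDF 0 v) (by fun_prop)]
  congr 1
  ext x
  have hv' : (v : ℝ) ≠ 0 := by exact_mod_cast hv
  simp only [gaussianPDF, Pi.mul_apply]
  rw [← ENNReal.ofReal_mul (gaussianPDFReal_nonneg _ _ _)]
  simp only [gaussianPDFReal]
  rw [mul_assoc (√_)⁻¹, ← Real.exp_add]
  congr 3
  field_simp
  ring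

lemma pi_withDensity {ι : Type*} [Fintype ι] {α : ι → Type*} [∀ i, MeasurableSpace (α i)]
    (μ : ∀ i, Measure (α i)) [∀ i, IsProbabilityMeasure (μ i)]
    (f : ∀ i, α i → ℝ≥0∞) (hf : ∀ i, Measurable (f i))
    [∀ i, SigmaFinite ((μ i).withDensity (f i))] :
    Measure.pi (fun i => (μ i).withDensity (f i)) =
      (Measure.pi μ).withDensity fun x => ∏ i, f i (x i) := by
  refine Measure.pi_eq fun s hs => ?_
  have hF : ∀ i, Measurable ((s i).indicator (f i)) := fun i => (hf i).indicator (hs i)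
  rw [withDensity_apply _ (.univ_pi hs), ← lintegral_indicator (.univ_pi hs)]
  have h1 : (Set.univ.pi s).indicator (fun x : ∀ i, α i => ∏ i, f i (x i)) =
      fun x => ∏ i, (s i).indicator (f i) (x i) := by
    classical
    ext x
    by_cases hx : x ∈ Set.univ.pi s
    · rw [Set.indicator_of_mem hx]
      exact Finset.prod_congr rfl fun i _ =>
        (Set.indicator_of_mem (hx i (Set.mem_univ i)) _).symm
    · rw [Set.indicator_of_notMem hx]
      simp only [Set.mem_univ_pi, not_forall] at hx
      obtain ⟨i, hi⟩ := hx
      exact (Finset.prod_eq_zero (Finset.mem_univ i) (Set.indicator_of_notMem hi _)).symm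
  rw [h1]
  have hind : iIndepFun (fun i (x : ∀ i, α i) => (s i).indicator (f i) (x i)) (Measure.pi μ) :=
    iIndepFun_pi (X := fun i => (s i).indicator (f i)) fun i => (hF i).aemeasurable
  rw [lintegral_prod_eq_prod_lintegral_of_indepFun Finset.univ _ hind
    fun i => (hF i).comp (measurable_pi_apply i)]
  refine Finset.prod_congr rfl fun i _ => ?_
  rw [withDensity_apply _ (hs i), ← lintegral_indicator (hs i)]
  exact (measurePreserving_eval μ i).lintegral_comp (hF i)

section GaussianShift

variable {ι : Type*} [Fintype ι] {v : ℝ≥0}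

lemma pi_gaussianReal_map_const_add (hv : v ≠ 0) (d : ι → ℝ) :
    (Measure.pi fun _ : ι => gaussianReal 0 v).map (fun z => d + z) =
      (Measure.pi fun _ : ι => gaussianReal 0 v).withDensity
        fun z => ENNReal.ofReal (gaussLR v d z) := by
  have h1 : (Measure.pi fun _ : ι => gaussianReal 0 v).map (fun z => d + z) =
      Measure.pi fun i => gaussianReal (d i) v := by
    have : ∀ i, (gaussianReal 0 v).map (fun x => d i + x) = gaussianReal (d i) v := fun i => by
      simpa using gaussianReal_map_const_add (μ := 0) (v := v) (d i)
    have hs : ∀ i, SigmaFinite ((gaussianReal 0 v).map (fun x => d i + x)) := fun i => by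
      rw [this]; infer_instance
    have h := Measure.pi_map_pi (μ := fun _ : ι => gaussianReal 0 v) (f := fun i x => d i + x)
      (fun i => by fun_prop)
    simp only [this] at h
    exact h
  rw [h1]
  have hd := fun i => gaussianReal_eq_withDensity_zero (d i) hv
  have : ∀ i, SigmaFinite ((gaussianReal 0 v).withDensity
      fun x => ENNReal.ofReal (Real.exp (d i * x / v - d i * d i / (2 * v)))) := fun i => by
    rw [← hd]; infer_instance
  simp only [hd]
  rw [pi_withDensity _ _ fun i => by fun_prop]
  congr 1
  ext z
  rw [← ENNReal.ofReal_prod_of_nonneg fun i _ => (Real.exp_pos _).le, ← Real.exp_sum]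
  simp only [gaussLR, dotProduct, Finset.sum_sub_distrib, Finset.sum_div]

lemma measurable_gaussLR (a : ℝ) (d : ι → ℝ) : Measurable (gaussLR a d) := by
  unfold gaussLR dotProduct
  fun_prop

lemma gaussLR_mul_gaussLR (hv : v ≠ 0) (d e z : ι → ℝ) :
    gaussLR v d z * gaussLR v e z = Real.exp (d ⬝ᵥ e / v) * gaussLR v (d + e) z := by
  have hv' : (v : ℝ) ≠ 0 := by exact_mod_cast hv
  simp only [gaussLR, ← Real.exp_add, add_dotProduct, dotProduct_add, dotProduct_comm e d]
  congr 1
  field_simp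
  ring

lemma integral_const_add_eq_integral_mul_gaussLR (hv : v ≠ 0) (d : ι → ℝ) (f : (ι → ℝ) → ℝ)
    (hf : Measurable f) :
    ∫ z, f (d + z) ∂(Measure.pi fun _ : ι => gaussianReal 0 v) =
      ∫ z, f z * gaussLR v d z ∂(Measure.pi fun _ : ι => gaussianReal 0 v) := by
  rw [← integral_map (φ := fun z => d + z) (by fun_prop) hf.aestronglyMeasurable,
    pi_gaussianReal_map_const_add hv]
  have := integral_withDensity_eq_integral_smul
    (μ := Measure.pi fun _ : ι => gaussianReal 0 v) (measurable_gaussLR v d).real_toNNReal f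
  refine this.trans (integral_congr_ae (.of_forall fun z => ?_))
  simp only [NNReal.smul_def, smul_eq_mul]
  rw [Real.coe_toNNReal (gaussLR v d z) (Real.exp_pos _).le, mul_comm]

lemma integral_gaussLR (hv : v ≠ 0) (d : ι → ℝ) :
    ∫ z, gaussLR v d z ∂(Measure.pi fun _ : ι => gaussianReal 0 v) = 1 := by
  have := integral_const_add_eq_integral_mul_gaussLR hv d (fun _ => 1) measurable_const
  simpa using this.symm

lemma integrable_gaussLR (hv : v ≠ 0) (d : ι → ℝ) :
    Integrable (gaussLR v d) (Measure.pi fun _ : ι => gaussianReal 0 v) :=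
  .of_integral_ne_zero (by rw [integral_gaussLR hv]; exact one_ne_zero)

lemma memLp_gaussLR (hv : v ≠ 0) (d : ι → ℝ) :
    MemLp (gaussLR v d) 2 (Measure.pi fun _ : ι => gaussianReal 0 v) := by
  rw [memLp_two_iff_integrable_sq (measurable_gaussLR v d).aestronglyMeasurable]
  simp only [sq, gaussLR_mul_gaussLR hv]
  exact (integrable_gaussLR hv _).const_mul _

lemma integral_gaussLR_mul_gaussLR (hv : v ≠ 0) (d e : ι → ℝ) :
    ∫ z, gaussLR v d z * gaussLR v e z ∂(Measure.pi fun _ : ι => gaussianReal 0 v) =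
      Real.exp (d ⬝ᵥ e / v) := by
  simp only [gaussLR_mul_gaussLR hv]
  rw [integral_const_mul, integral_gaussLR hv, mul_one]

/-- A Barankin-type lower bound on a second moment in terms of the means under finitely many
translates of the Gaussian measure. -/
lemma two_mul_sum_sub_le_integral_sq {κ : Type*} [Fintype κ] (hv : v ≠ 0)
    {G : (ι → ℝ) → ℝ} (hG : MemLp G 2 (Measure.pi fun _ : ι => gaussianReal 0 v))
    (c : κ → ℝ) (d : κ → ι → ℝ) :
    2 * ∑ i, c i * ∫ z, G z * gaussLR v (d i) z ∂(Measure.pi fun _ : ι => gaussianReal 0 v)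
      - ∑ i, ∑ j, c i * c j * Real.exp (d i ⬝ᵥ d j / v)
      ≤ ∫ z, G z ^ 2 ∂(Measure.pi fun _ : ι => gaussianReal 0 v) := by
  set π := Measure.pi fun _ : ι => gaussianReal 0 v
  have h1 : ∀ i, Integrable (fun z => G z * gaussLR v (d i) z) π := fun i =>
    hG.integrable_mul (memLp_gaussLR hv (d i))
  have h2 : ∀ i j, Integrable (fun z => gaussLR v (d i) z * gaussLR v (d j) z) π := fun i j =>
    (memLp_gaussLR hv (d i)).integrable_mul (memLp_gaussLR hv (d j))
  have h3 : Integrable (fun z => ∑ i, c i * (G z * gaussLR v (d i) z)) π :=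
    integrable_finsetSum _ fun i _ => (h1 i).const_mul _
  have h4 : Integrable
      (fun z => ∑ i, ∑ j, c i * c j * (gaussLR v (d i) z * gaussLR v (d j) z)) π :=
    integrable_finsetSum _ fun i _ => integrable_finsetSum _ fun j _ => (h2 i j).const_mul _
  have h0 : 0 ≤ ∫ z, (G z - ∑ i, c i * gaussLR v (d i) z) ^ 2 ∂π :=
    integral_nonneg fun z => sq_nonneg _
  have hexp : ∀ z, (G z - ∑ i, c i * gaussLR v (d i) z) ^ 2 =
      (G z ^ 2 - 2 * ∑ i, c i * (G z * gaussLR v (d i) z)) +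
        ∑ i, ∑ j, c i * c j * (gaussLR v (d i) z * gaussLR v (d j) z) := fun z => by
    have e1 : ∑ i, ∑ j, c i * c j * (gaussLR v (d i) z * gaussLR v (d j) z) =
        (∑ i, c i * gaussLR v (d i) z) * ∑ i, c i * gaussLR v (d i) z := by
      rw [Finset.sum_mul_sum]
      exact Finset.sum_congr rfl fun i _ => Finset.sum_congr rfl fun j _ => by ring
    have e2 : ∑ i, c i * (G z * gaussLR v (d i) z) = G z * ∑ i, c i * gaussLR v (d i) z := by
      rw [Finset.mul_sum]
      exact Finset.sum_congr rfl fun i _ => by ring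
    rw [e1, e2]
    ring
  simp only [hexp] at h0
  have h6 : Integrable (fun z => G z ^ 2 - 2 * ∑ i, c i * (G z * gaussLR v (d i) z)) π :=
    hG.integrable_sq.sub (h3.const_mul 2)
  rw [integral_add h6 h4,
    integral_sub hG.integrable_sq (h3.const_mul 2), integral_const_mul,
    integral_finsetSum _ (fun i _ => (h1 i).const_mul _),
    integral_finsetSum _ (fun i _ => integrable_finsetSum _ fun j _ => (h2 i j).const_mul _)] at h0
  have h5 : ∀ i, ∫ z, ∑ j, c i * c j * (gaussLR v (d i) z * gaussLR v (d j) z) ∂π =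
      ∑ j, c i * c j * Real.exp (d i ⬝ᵥ d j / v) := fun i => by
    rw [integral_finsetSum _ (fun j _ => (h2 i j).const_mul _)]
    refine Finset.sum_congr rfl fun j _ => ?_
    rw [integral_const_mul, integral_gaussLR_mul_gaussLR hv]
  simp only [h5, integral_const_mul] at h0
  linarith

lemma tendsto_exp_sq_mul_sub_one_div (q : ℝ) :
    Filter.Tendsto (fun t : ℝ => (t ^ 2)⁻¹ * (Real.exp (t ^ 2 * q) - 1)) (nhdsWithin 0 {0}ᶜ)
      (nhds q) := by
  have h : HasDerivAt (fun u : ℝ => Real.exp (u * q)) q 0 := by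
    simpa using ((hasDerivAt_id (0 : ℝ)).mul_const q).exp
  have hsq : Filter.Tendsto (fun t : ℝ => t ^ 2) (nhdsWithin 0 {0}ᶜ) (nhdsWithin 0 {0}ᶜ) := by
    refine tendsto_nhdsWithin_iff.2 ⟨?_, ?_⟩
    · have : Filter.Tendsto (fun t : ℝ => t ^ 2) (nhds 0) (nhds (0 ^ 2)) :=
        (continuous_pow 2).tendsto 0
      rw [zero_pow two_ne_zero] at this
      exact this.mono_left nhdsWithin_le_nhds
    · filter_upwards [self_mem_nhdsWithin] with t ht
      exact pow_ne_zero 2 ht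
  simpa [Function.comp_def] using h.tendsto_slope_zero.comp hsq

/-- A Cramér–Rao-type bound on a second moment under `N(0, v I)`, in terms of the mean and its
partial derivatives at the point `-r`, where `r` is orthogonal to the columns of `A`. -/
lemma exp_mul_le_integral_sq {κ : Type*} [Fintype κ] (hv : v ≠ 0)
    {G : (ι → ℝ) → ℝ} (hG : MemLp G 2 (Measure.pi fun _ : ι => gaussianReal 0 v))
    (A : Matrix ι κ ℝ) (r : ι → ℝ) (hr : Aᵀ *ᵥ r = 0) (b : κ → ℝ)
    (hder : ∀ k, HasDerivAt (fun t : ℝ => ∫ z, G z * gaussLR v (t • A.col k - r) z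
      ∂(Measure.pi fun _ : ι => gaussianReal 0 v)) (b k) 0) (a : κ → ℝ) :
    Real.exp (-(r ⬝ᵥ r) / v) *
        (2 * ((∫ z, G z * gaussLR v (-r) z ∂(Measure.pi fun _ : ι => gaussianReal 0 v)) ^ 2
            + ∑ k, a k * b k)
          - ((∫ z, G z * gaussLR v (-r) z ∂(Measure.pi fun _ : ι => gaussianReal 0 v)) ^ 2
            + ∑ k, ∑ l, a k * a l * ((Aᵀ * A) k l / v)))
      ≤ ∫ z, G z ^ 2 ∂(Measure.pi fun _ : ι => gaussianReal 0 v) := by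
  set π := Measure.pi fun _ : ι => gaussianReal 0 v
  set c₀ := ∫ z, G z * gaussLR v (-r) z ∂π
  have hv' : (v : ℝ) ≠ 0 := by exact_mod_cast hv
  have hr' : ∀ k, A.col k ⬝ᵥ r = 0 := fun k => congrFun hr k
  have lim : Filter.Tendsto (fun t : ℝ => Real.exp (-(r ⬝ᵥ r) / v) *
      (2 * (c₀ ^ 2 + ∑ k, a k * (t⁻¹ * ((∫ z, G z * gaussLR v (t • A.col k - r) z ∂π) - c₀)))
        - (c₀ ^ 2 + ∑ k, ∑ l, a k * a l *
          ((t ^ 2)⁻¹ * (Real.exp (t ^ 2 * ((Aᵀ * A) k l / v)) - 1)))))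
      (nhdsWithin 0 {0}ᶜ)
      (nhds (Real.exp (-(r ⬝ᵥ r) / v) * (2 * (c₀ ^ 2 + ∑ k, a k * b k)
        - (c₀ ^ 2 + ∑ k, ∑ l, a k * a l * ((Aᵀ * A) k l / v))))) := by
    refine ((((tendsto_finsetSum _ fun k _ => ?_).const_add _).const_mul _).sub
      ((tendsto_finsetSum _ fun k _ => tendsto_finsetSum _ fun l _ =>
        (tendsto_exp_sq_mul_sub_one_div _).const_mul _).const_add _)).const_mul _
    have := (hder k).tendsto_slope_zero
    simp only [zero_add, zero_smul, zero_sub, smul_eq_mul] at this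
    exact this.const_mul _
  refine le_of_tendsto lim ?_
  filter_upwards [self_mem_nhdsWithin] with t ht
  replace ht : t ≠ 0 := ht
  set E := Real.exp (r ⬝ᵥ r / v) with hE
  have hE0 : E ≠ 0 := (Real.exp_pos _).ne'
  have hEinv : Real.exp (-(r ⬝ᵥ r) / v) = E⁻¹ := by rw [neg_div, Real.exp_neg]
  have key := two_mul_sum_sub_le_integral_sq hv hG
    (fun o : Option κ => o.elim (E⁻¹ * (c₀ - ∑ k, a k * t⁻¹)) fun k => E⁻¹ * (a k * t⁻¹))
    (fun o : Option κ => o.elim (-r) fun k => t • A.col k - r)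
  have d0 : -r ⬝ᵥ -r = r ⬝ᵥ r := by simp
  have d1 : ∀ k, -r ⬝ᵥ (t • A.col k - r) = r ⬝ᵥ r := fun k => by
    simp [dotProduct_sub, dotProduct_comm r, hr']
  have d2 : ∀ k, (t • A.col k - r) ⬝ᵥ -r = r ⬝ᵥ r := fun k => by
    rw [dotProduct_comm, d1]
  have d3 : ∀ k l, Real.exp ((t • A.col k - r) ⬝ᵥ (t • A.col l - r) / v) =
      E * Real.exp (t ^ 2 * ((Aᵀ * A) k l / v)) := fun k l => by
    have : (Aᵀ * A) k l = A.col k ⬝ᵥ A.col l := rfl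
    rw [hE, ← Real.exp_add, this]
    congr 1
    simp only [dotProduct_sub, sub_dotProduct, smul_dotProduct, dotProduct_smul, smul_eq_mul,
      dotProduct_comm r (A.col _), hr']
    ring
  simp only [Fintype.sum_option, Option.elim, d0, d1, d2, d3, ← hE] at key
  refine le_trans (le_of_eq ?_) key
  rw [hEinv]
  have s1 : ∑ k, a k * (t⁻¹ * ((∫ z, G z * gaussLR v (t • A.col k - r) z ∂π) - c₀)) =
      ∑ k, a k * t⁻¹ * (∫ z, G z * gaussLR v (t • A.col k - r) z ∂π) -
        (∑ k, a k * t⁻¹) * c₀ := by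
    rw [Finset.sum_mul, ← Finset.sum_sub_distrib]
    exact Finset.sum_congr rfl fun k _ => by ring
  have s2 : ∑ k, ∑ l, a k * a l * ((t ^ 2)⁻¹ * (Real.exp (t ^ 2 * ((Aᵀ * A) k l / v)) - 1)) =
      ∑ k, ∑ l, a k * t⁻¹ * (a l * t⁻¹) * Real.exp (t ^ 2 * ((Aᵀ * A) k l / v)) -
        (∑ k, a k * t⁻¹) * ∑ k, a k * t⁻¹ := by
    rw [Finset.sum_mul_sum, ← Finset.sum_sub_distrib]
    refine Finset.sum_congr rfl fun k _ => ?_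
    rw [← Finset.sum_sub_distrib]
    exact Finset.sum_congr rfl fun l _ => by ring
  have s3 : ∑ k, E⁻¹ * (a k * t⁻¹) * (∫ z, G z * gaussLR v (t • A.col k - r) z ∂π) =
      E⁻¹ * ∑ k, a k * t⁻¹ * (∫ z, G z * gaussLR v (t • A.col k - r) z ∂π) := by
    rw [Finset.mul_sum]
    exact Finset.sum_congr rfl fun k _ => by ring
  have s4 : ∑ k, E⁻¹ * (c₀ - ∑ k, a k * t⁻¹) * (E⁻¹ * (a k * t⁻¹)) * E =
      E⁻¹ * (c₀ - ∑ k, a k * t⁻¹) * ∑ k, a k * t⁻¹ := by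
    rw [Finset.mul_sum]
    exact Finset.sum_congr rfl fun k _ => by field_simp
  have s5 : ∑ k, (E⁻¹ * (a k * t⁻¹) * (E⁻¹ * (c₀ - ∑ k, a k * t⁻¹)) * E +
        ∑ l, E⁻¹ * (a k * t⁻¹) * (E⁻¹ * (a l * t⁻¹)) *
          (E * Real.exp (t ^ 2 * ((Aᵀ * A) k l / v)))) =
      E⁻¹ * (c₀ - ∑ k, a k * t⁻¹) * (∑ k, a k * t⁻¹) +
        E⁻¹ * ∑ k, ∑ l, a k * t⁻¹ * (a l * t⁻¹) * Real.exp (t ^ 2 * ((Aᵀ * A) k l / v)) := by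
    rw [Finset.sum_add_distrib, Finset.mul_sum, Finset.mul_sum]
    congr 1
    · exact Finset.sum_congr rfl fun k _ => by field_simp
    · refine Finset.sum_congr rfl fun k _ => ?_
      rw [Finset.mul_sum]
      exact Finset.sum_congr rfl fun l _ => by field_simp
  rw [s1, s2, s3, s4, s5]
  field_simp
  ring

end GaussianShift

lemma slgmMean_eq_integral_mul_gaussLR {M N : ℕ} (H : Matrix (Fin M) (Fin N) ℝ) {σ : ℝ}
    (hσ : 0 < σ) {g : (Fin M → ℝ) → ℝ} (hg : Measurable g) (x₀ x : Fin N → ℝ) :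
    slgmMean H σ g x = ∫ z, g (H *ᵥ x₀ + z) *
      gaussLR ((σ ^ 2).toNNReal : ℝ) (H *ᵥ x - H *ᵥ x₀) z
        ∂(Measure.pi fun _ : Fin M => gaussianReal 0 (σ ^ 2).toNNReal) := by
  have hv : (σ ^ 2).toNNReal ≠ 0 := by simpa using hσ.ne'
  rw [← integral_const_add_eq_integral_mul_gaussLR hv _ (fun z => g (H *ᵥ x₀ + z))
    (by fun_prop), slgmMean, slgmP, integral_map (by fun_prop) hg.aestronglyMeasurable]
  congr 1 with z
  congr 1
  abel

lemma isUnit_det_gramK {M N : ℕ} {H : Matrix (Fin M) (Fin N) ℝ} {K : Finset (Fin N)}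
    (h : LinearIndependent ℝ (fun k : ↥K => fun m => H m k.1)) : IsUnit (gramK H K).det := by
  have hinj : Function.Injective (Hsub H K).mulVec := Matrix.mulVec_injective_iff.2 h
  have := (Matrix.PosDef.conjTranspose_mul_self (Hsub H K) hinj).det_pos
  rw [Matrix.conjTranspose_eq_transpose_of_trivial] at this
  exact this.ne'.isUnit

lemma mulVec_xtilde {M N : ℕ} (H : Matrix (Fin M) (Fin N) ℝ) (K : Finset (Fin N))
    (x₀ : Fin N → ℝ) : H *ᵥ xtilde H K x₀ = projK H K *ᵥ (H *ᵥ x₀) := by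
  have h : H *ᵥ xtilde H K x₀ =
      Hsub H K *ᵥ (((gramK H K)⁻¹ * (Hsub H K)ᵀ) *ᵥ (H *ᵥ x₀)) := by
    ext m
    simp only [mulVec, dotProduct, Hsub, of_apply, xtilde]
    rw [← Finset.sum_subset (Finset.subset_univ K) fun l _ hl => by simp [hl],
      ← Finset.sum_coe_sort K]
    exact Finset.sum_congr rfl fun l _ => by simp
  rw [h, mulVec_mulVec, projK, Matrix.mul_assoc]

lemma transpose_Hsub_mulVec_sub_projK {M N : ℕ} {H : Matrix (Fin M) (Fin N) ℝ}
    {K : Finset (Fin N)} (hdet : IsUnit (gramK H K).det) (y : Fin M → ℝ) :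
    (Hsub H K)ᵀ *ᵥ (y - projK H K *ᵥ y) = 0 := by
  have : (Hsub H K)ᵀ * projK H K = (Hsub H K)ᵀ := by
    rw [projK, Matrix.mul_assoc, ← Matrix.mul_assoc,
      show (Hsub H K)ᵀ * Hsub H K = gramK H K from rfl, ← Matrix.mul_assoc, Matrix.mul_nonsing_inv _ hdet, Matrix.one_mul]
  rw [mulVec_sub, mulVec_mulVec, this, sub_self]

/-- Novel CRB-type bound. With `P = H_K (H_KᵀH_K)⁻¹ H_Kᵀ` and `x̃₀`
the vector supported on `K` with `H x̃₀ = P H x₀`, and `b_l` the partial derivatives of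
the mean function `γ` at `x̃₀` along `e_l`, `l ∈ K`, one has `H_KᵀH_K` invertible and
`v(ĝ;x₀) ≥ exp(−‖(I−P)Hx₀‖²/σ²) [σ² bᵀ(H_KᵀH_K)⁻¹ b + γ(x̃₀)²] − γ(x₀)²`. -/
theorem slgm_crb_type_bound {N M S : ℕ} (hN : 1 ≤ N) (hM : 1 ≤ M)
    (hS1 : 1 ≤ S) (hSN : S ≤ N)
    (H : Matrix (Fin M) (Fin N) ℝ) (σ : ℝ) (hσ : 0 < σ)
    (hspark : ∀ K : Finset (Fin N), K.card ≤ S →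
      LinearIndependent ℝ (fun k : ↥K => fun m => H m k.1))
    (x₀ : Fin N → ℝ) (hx₀ : x₀ ∈ sparseSet N S)
    (K : Finset (Fin N)) (hKne : K.Nonempty) (hKS : K.card ≤ S)
    (g : (Fin M → ℝ) → ℝ) (hg : Measurable g)
    (hint : ∀ x ∈ sparseSet N S, Integrable g (slgmP H σ x))
    (hsq : Integrable (fun y => g y ^ 2) (slgmP H σ x₀))
    (b : Fin N → ℝ)
    (hder : ∀ l ∈ K, HasDerivAt
      (fun t : ℝ => slgmMean H σ g (xtilde H K x₀ + t • (Pi.single l (1:ℝ) : Fin N → ℝ)))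
      (b l) 0) :
    IsUnit (gramK H K).det ∧
    Real.exp (-(∑ m, (H.mulVec x₀ - (projK H K).mulVec (H.mulVec x₀)) m ^ 2) / σ ^ 2) *
        (σ ^ 2 * ∑ k : ↥K, ∑ l : ↥K, b k.1 * (gramK H K)⁻¹ k l * b l.1
          + slgmMean H σ g (xtilde H K x₀) ^ 2)
      - slgmMean H σ g x₀ ^ 2
      ≤ slgmVar H σ g x₀ := by
  have hdet : IsUnit (gramK H K).det := isUnit_det_gramK (hspark K hKS)
  refine ⟨hdet, ?_⟩
  set v := (σ ^ 2).toNNReal with hv_def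
  have hv : v ≠ 0 := by simpa [hv_def] using hσ.ne'
  have hvσ : (v : ℝ) = σ ^ 2 := Real.coe_toNNReal _ (sq_nonneg σ)
  set π := Measure.pi fun _ : Fin M => gaussianReal 0 v with hπ
  set r := H *ᵥ x₀ - projK H K *ᵥ (H *ᵥ x₀) with hr
  have hshift : Measurable fun z : Fin M → ℝ => H *ᵥ x₀ + z := by fun_prop
  have hprob : IsProbabilityMeasure (slgmP H σ x₀) :=
    Measure.isProbabilityMeasure_map hshift.aemeasurable
  have hgL2 : MemLp g 2 (slgmP H σ x₀) :=
    (memLp_two_iff_integrable_sq hg.aestronglyMeasurable).2 hsq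
  have hG : MemLp (fun z => g (H *ᵥ x₀ + z)) 2 π :=
    (memLp_map_measure_iff hg.aestronglyMeasurable hshift.aemeasurable).1 hgL2
  have hvar : slgmVar H σ g x₀ = ∫ z, g (H *ᵥ x₀ + z) ^ 2 ∂π - slgmMean H σ g x₀ ^ 2 := by
    have h := variance_eq_sub hgL2
    rw [variance_eq_integral hg.aemeasurable] at h
    refine h.trans ?_
    congr 1
    exact integral_map hshift.aemeasurable (hg.pow_const 2).aestronglyMeasurable
  have hmean : ∀ (k : K) (t : ℝ),
      slgmMean H σ g (xtilde H K x₀ + t • (Pi.single k.1 (1 : ℝ) : Fin N → ℝ)) =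
        ∫ z, g (H *ᵥ x₀ + z) * gaussLR v (t • (Hsub H K).col k - r) z ∂π := fun k t => by
    rw [slgmMean_eq_integral_mul_gaussLR H hσ hg x₀]
    have : H *ᵥ (xtilde H K x₀ + t • (Pi.single k.1 (1 : ℝ) : Fin N → ℝ)) - H *ᵥ x₀ =
        t • (Hsub H K).col k - r := by
      have hcol : H *ᵥ (Pi.single k.1 (1 : ℝ) : Fin N → ℝ) = (Hsub H K).col k := by
        ext m
        simp [Hsub]
      rw [mulVec_add, mulVec_xtilde, mulVec_smul, hcol, hr]
      abel
    rw [this]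
  have hmean₀ : slgmMean H σ g (xtilde H K x₀) =
      ∫ z, g (H *ᵥ x₀ + z) * gaussLR v (-r) z ∂π := by
    have : H *ᵥ xtilde H K x₀ - H *ᵥ x₀ = -r := by
      rw [mulVec_xtilde, hr, neg_sub]
    rw [slgmMean_eq_integral_mul_gaussLR H hσ hg x₀, this]
  set β : K → ℝ := fun k => b k.1 with hβ
  have key := exp_mul_le_integral_sq hv hG (Hsub H K) r
    (transpose_Hsub_mulVec_sub_projK hdet _) β
    (fun k => by simpa only [hmean] using hder k.1 k.2) (σ ^ 2 • ((gramK H K)⁻¹ *ᵥ β))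
  set a := σ ^ 2 • ((gramK H K)⁻¹ *ᵥ β) with ha
  have hGa : gramK H K *ᵥ a = σ ^ 2 • β := by
    rw [ha, mulVec_smul, mulVec_mulVec, Matrix.mul_nonsing_inv _ hdet, one_mulVec]
  have hab : ∑ k, a k * β k =
      σ ^ 2 * ∑ k : ↥K, ∑ l : ↥K, b k.1 * (gramK H K)⁻¹ k l * b l.1 := by
    simp only [ha, hβ, Pi.smul_apply, smul_eq_mul, mulVec, dotProduct, Finset.mul_sum,
      Finset.sum_mul]
    exact Finset.sum_congr rfl fun k _ => Finset.sum_congr rfl fun l _ => by ring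
  have haa : ∑ k, ∑ l, a k * a l * (((Hsub H K)ᵀ * Hsub H K) k l / v) = ∑ k, a k * β k := by
    refine Finset.sum_congr rfl fun k _ => ?_
    have h := congrFun hGa k
    simp only [mulVec, dotProduct, Pi.smul_apply, smul_eq_mul] at h
    have hσ2 : σ ^ 2 ≠ 0 := by positivity
    calc ∑ l, a k * a l * (((Hsub H K)ᵀ * Hsub H K) k l / v)
        = a k / σ ^ 2 * ∑ l, gramK H K k l * a l := by
          rw [Finset.mul_sum, hvσ]
          exact Finset.sum_congr rfl fun l _ => by rw [gramK]; ring
      _ = a k * β k := by rw [h]; field_simp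
  have hrr : ∑ m, r m ^ 2 = r ⬝ᵥ r := by simp only [dotProduct, sq]
  rw [haa, ← hmean₀, hab, hvσ, ← hπ] at key
  rw [hvar, hrr]
  linarith
end

section
/- (Sparse CRB for the SSNM.) Consider the SSNM. Let x₀ ∈ X_S and let ĝ : ℝ^N → ℝ be Borel measurable, P_x-integrable for every x ∈ X_S, with ∫ ĝ² dP_{x₀} < ∞; write γ(x) = ∫ ĝ dP_x for x ∈ X_S. (a) If |supp(x₀)| < S and for each l ∈ {1,…,N} the map t ↦ γ(x₀ + t e_l) is differentiable at t = 0 with derivative b_l, then v(ĝ; x₀) ≥ σ² · Σ_{l=1}^N b_l². (b) If |supp(x₀)| = S and for each l ∈ supp(x₀) the map t ↦ γ(x₀ + t e_l) is differentiable at t = 0 with derivative b_l, then v(ĝ; x₀) ≥ σ² · Σ_{l∈supp(x₀)} b_l². -/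
open MeasureTheory ProbabilityTheory

/-- The distribution `P_x` of `y = x + n` where `n` has i.i.d. `N(0,σ²)` entries
(sparse signal in noise model, SSNM). -/
noncomputable def ssnmP {N : ℕ} (σ : ℝ) (x : Fin N → ℝ) : Measure (Fin N → ℝ) :=
  Measure.map (fun n => x + n)
    (Measure.pi fun _ : Fin N => gaussianReal 0 ((σ ^ 2).toNNReal))

/-- Mean function `γ_ĝ(x) = ∫ ĝ dP_x` of an estimator. -/
noncomputable def ssnmMean {N : ℕ} (σ : ℝ) (g : (Fin N → ℝ) → ℝ) (x : Fin N → ℝ) : ℝ :=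
  ∫ y, g y ∂ ssnmP σ x

/-- Variance `v(ĝ;x) = ∫ (ĝ(y) − γ_ĝ(x))² dP_x(y)` of an estimator. -/
noncomputable def ssnmVar {N : ℕ} (σ : ℝ) (g : (Fin N → ℝ) → ℝ) (x : Fin N → ℝ) : ℝ :=
  ∫ y, (g y - ssnmMean σ g x) ^ 2 ∂ ssnmP σ x

section GaussianShift

variable {ι : Type*} [Fintype ι]

/-- A product of measures with integrable densities has the product of the densities as its
density. -/
lemma pi_withDensity_ofReal {E : ι → Type*} {mE : ∀ i, MeasurableSpace (E i)}
    {μ : ∀ i, Measure (E i)} [∀ i, SigmaFinite (μ i)] {f : ∀ i, E i → ℝ}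
    (hf : ∀ i, Integrable (f i) (μ i)) (hf0 : ∀ i x, 0 ≤ f i x) :
    Measure.pi (fun i => (μ i).withDensity fun x => ENNReal.ofReal (f i x)) =
      (Measure.pi μ).withDensity fun x => ENNReal.ofReal (∏ i, f i (x i)) := by
  have (i : ι) : IsFiniteMeasure ((μ i).withDensity fun x => ENNReal.ofReal (f i x)) :=
    isFiniteMeasure_withDensity_ofReal (hf i).2
  refine Measure.pi_eq fun s hs => ?_
  have hbox : MeasurableSet (Set.univ.pi s) := MeasurableSet.univ_pi hs
  have hind (x : ∀ i, E i) : (Set.univ.pi s).indicator (fun x => ∏ i, f i (x i)) x =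
      ∏ i, (s i).indicator (f i) (x i) := by
    by_cases hx : x ∈ Set.univ.pi s
    · rw [Set.indicator_of_mem hx]
      exact Finset.prod_congr rfl fun i _ =>
        (Set.indicator_of_mem (hx i (Set.mem_univ i)) (f i)).symm
    · rw [Set.indicator_of_notMem hx]
      simp only [Set.mem_pi, Set.mem_univ, true_implies, not_forall] at hx
      obtain ⟨i, hi⟩ := hx
      exact (Finset.prod_eq_zero (Finset.mem_univ i) (Set.indicator_of_notMem hi (f i))).symm
  rw [withDensity_apply _ hbox,
    ← ofReal_integral_eq_lintegral_ofReal (Integrable.fintype_prod_dep hf).integrableOn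
      (ae_of_all _ fun x => Finset.prod_nonneg fun i _ => hf0 i (x i)),
    ← integral_indicator hbox, integral_congr_ae (ae_of_all _ hind),
    integral_fintype_prod_eq_prod (f := fun i => (s i).indicator (f i)),
    ENNReal.ofReal_prod_of_nonneg fun i _ =>
      integral_nonneg fun x => Set.indicator_nonneg (fun y _ => hf0 i y) x]
  refine Finset.prod_congr rfl fun i _ => ?_
  rw [withDensity_apply _ (hs i), integral_indicator (hs i),
    ofReal_integral_eq_lintegral_ofReal (hf i).integrableOn (ae_of_all _ (hf0 i))]

lemma integrable_exp_shift_gaussianReal (m u : ℝ) (v : NNReal) :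
    Integrable (fun y => Real.exp ((u * (y - m) - u ^ 2 / 2) / v)) (gaussianReal m v) := by
  convert (integrable_exp_mul_gaussianReal (μ := m) (v := v) (u / v)).mul_const
    (Real.exp ((-(u * m) - u ^ 2 / 2) / v)) using 2 with y
  rw [← Real.exp_add]
  ring_nf

lemma gaussianReal_add_eq_withDensity (m u : ℝ) {v : NNReal} (hv : v ≠ 0) :
    gaussianReal (m + u) v = (gaussianReal m v).withDensity
      fun y => ENNReal.ofReal (Real.exp ((u * (y - m) - u ^ 2 / 2) / v)) := by
  rw [gaussianReal_of_var_ne_zero _ hv, gaussianReal_of_var_ne_zero _ hv,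
    ← withDensity_mul _ (measurable_gaussianPDF m v) (by fun_prop)]
  congr 1
  ext y
  have hv' : (v : ℝ) ≠ 0 := by exact_mod_cast hv
  rw [Pi.mul_apply, gaussianPDF, gaussianPDF, ← ENNReal.ofReal_mul (gaussianPDFReal_nonneg _ _ _),
    gaussianPDFReal, gaussianPDFReal, mul_assoc (_⁻¹), ← Real.exp_add]
  congr 3
  field_simp
  ring

/-- The density of the Gaussian product measure centred at `x + u` with respect to the one centred
at `x`, with variance `v` in each coordinate. -/
noncomputable def gaussianShiftDensity (v : NNReal) (x u y : ι → ℝ) : ℝ :=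
  ∏ i, Real.exp ((u i * (y i - x i) - u i ^ 2 / 2) / v)

lemma gaussianShiftDensity_nonneg (v : NNReal) (x u y : ι → ℝ) :
    0 ≤ gaussianShiftDensity v x u y :=
  Finset.prod_nonneg fun _ _ => (Real.exp_pos _).le

lemma measurable_gaussianShiftDensity (v : NNReal) (x u : ι → ℝ) :
    Measurable (gaussianShiftDensity v x u) := by
  unfold gaussianShiftDensity
  fun_prop

lemma integrable_gaussianShiftDensity (v : NNReal) (x u : ι → ℝ) :
    Integrable (gaussianShiftDensity v x u) (Measure.pi fun i => gaussianReal (x i) v) :=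
  Integrable.fintype_prod fun i => integrable_exp_shift_gaussianReal (x i) (u i) v

lemma pi_gaussianReal_add_eq_withDensity {v : NNReal} (hv : v ≠ 0) (x u : ι → ℝ) :
    Measure.pi (fun i => gaussianReal ((x + u) i) v) =
      (Measure.pi fun i => gaussianReal (x i) v).withDensity
        fun y => ENNReal.ofReal (gaussianShiftDensity v x u y) := by
  simp_rw [Pi.add_apply, gaussianReal_add_eq_withDensity _ _ hv]
  exact pi_withDensity_ofReal (fun i => integrable_exp_shift_gaussianReal (x i) (u i) v)
    fun _ _ => (Real.exp_pos _).le

lemma integral_pi_gaussianReal_add {v : NNReal} (hv : v ≠ 0) (x u : ι → ℝ) (g : (ι → ℝ) → ℝ) :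
    ∫ y, g y ∂(Measure.pi fun i => gaussianReal ((x + u) i) v) =
      ∫ y, g y * gaussianShiftDensity v x u y ∂(Measure.pi fun i => gaussianReal (x i) v) := by
  rw [pi_gaussianReal_add_eq_withDensity hv, integral_withDensity_eq_integral_toReal_smul
    (measurable_gaussianShiftDensity v x u).ennreal_ofReal
    (ae_of_all _ fun _ => ENNReal.ofReal_lt_top)]
  simp_rw [ENNReal.toReal_ofReal (gaussianShiftDensity_nonneg v x u _), smul_eq_mul, mul_comm]

lemma integral_gaussianShiftDensity {v : NNReal} (hv : v ≠ 0) (x u : ι → ℝ) :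
    ∫ y, gaussianShiftDensity v x u y ∂(Measure.pi fun i => gaussianReal (x i) v) = 1 := by
  simpa using (integral_pi_gaussianReal_add hv x u fun _ => 1).symm

lemma gaussianShiftDensity_mul (v : NNReal) (x u w y : ι → ℝ) :
    gaussianShiftDensity v x u y * gaussianShiftDensity v x w y =
      Real.exp ((∑ i, u i * w i) / v) * gaussianShiftDensity v x (u + w) y := by
  simp_rw [gaussianShiftDensity, ← Real.exp_sum, ← Real.exp_add, ← Finset.sum_div,
    ← add_div, ← Finset.sum_add_distrib, Pi.add_apply]
  congr 2
  exact Finset.sum_congr rfl fun i _ => by ring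

lemma integral_gaussianShiftDensity_mul {v : NNReal} (hv : v ≠ 0) (x u w : ι → ℝ) :
    ∫ y, gaussianShiftDensity v x u y * gaussianShiftDensity v x w y
      ∂(Measure.pi fun i => gaussianReal (x i) v) = Real.exp ((∑ i, u i * w i) / v) := by
  simp_rw [gaussianShiftDensity_mul, integral_const_mul, integral_gaussianShiftDensity hv, mul_one]

lemma memLp_gaussianShiftDensity (v : NNReal) (x u : ι → ℝ) :
    MemLp (gaussianShiftDensity v x u) 2 (Measure.pi fun i => gaussianReal (x i) v) := by
  rw [memLp_two_iff_integrable_sq (measurable_gaussianShiftDensity v x u).aestronglyMeasurable]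
  simp_rw [sq, gaussianShiftDensity_mul]
  exact (integrable_gaussianShiftDensity v x (u + u)).const_mul _

end GaussianShift

lemma two_mul_integral_mul_sub_le_integral_sq {Ω : Type*} {mΩ : MeasurableSpace Ω}
    {μ : Measure Ω} {X Y : Ω → ℝ} (hX : MemLp X 2 μ) (hY : MemLp Y 2 μ) (c : ℝ) :
    2 * c * ∫ ω, X ω * Y ω ∂μ - c ^ 2 * ∫ ω, Y ω ^ 2 ∂μ ≤ ∫ ω, X ω ^ 2 ∂μ := by
  have hXY : Integrable (fun ω => X ω * Y ω) μ := hX.integrable_mul hY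
  have hY2 := hY.integrable_sq
  rw [← integral_const_mul, ← integral_const_mul,
    ← integral_sub (hXY.const_mul _) (hY2.const_mul _)]
  refine integral_mono ((hXY.const_mul _).sub (hY2.const_mul _)) hX.integrable_sq fun ω => ?_
  dsimp only
  linarith [sq_nonneg (X ω - c * Y ω)]

lemma ssnmP_eq_pi {N : ℕ} (σ : ℝ) (x : Fin N → ℝ) :
    ssnmP σ x = Measure.pi fun i => gaussianReal (x i) (σ ^ 2).toNNReal := by
  have h := Measure.pi_map_pi (μ := fun _ : Fin N => gaussianReal 0 (σ ^ 2).toNNReal)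
    (f := fun i n => x i + n) fun i => by fun_prop
  simp_rw [gaussianReal_map_const_add, zero_add] at h
  exact h

/-- A Hammersley–Chapman–Robbins type bound, obtained by comparing `P_{x₀}` with the measures
`P_{x₀ + t e_l}`, `l ∈ K`, for a fixed `t`. -/
lemma ssnmVar_ge_finite_difference {N : ℕ} {σ : ℝ} (hσ : 0 < σ) (x₀ : Fin N → ℝ) {g : (Fin N → ℝ) → ℝ}
    (hg : MemLp g 2 (ssnmP σ x₀)) (b : Fin N → ℝ) (K : Finset (Fin N)) (t : ℝ) :
    2 * σ ^ 2 * ∑ l ∈ K, b l * (t⁻¹ *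
        (ssnmMean σ g (x₀ + t • (Pi.single l (1:ℝ) : Fin N → ℝ)) - ssnmMean σ g x₀)) -
      (σ ^ 2) ^ 2 * ∑ l ∈ K, b l ^ 2 * ((t ^ 2)⁻¹ * (Real.exp (t ^ 2 / σ ^ 2) - 1)) ≤
    ssnmVar σ g x₀ := by
  set v := (σ ^ 2).toNNReal with hv
  have hvσ : (v : ℝ) = σ ^ 2 := Real.coe_toNNReal _ (by positivity)
  have hv0 : v ≠ 0 := by simpa [hv] using hσ.ne'
  have hprob : IsProbabilityMeasure (ssnmP σ x₀) := by rw [ssnmP_eq_pi]; infer_instance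
  let u (l : Fin N) : Fin N → ℝ := t • Pi.single l 1
  let L (l : Fin N) : (Fin N → ℝ) → ℝ := gaussianShiftDensity v x₀ (u l)
  have hL (l) : MemLp (L l) 2 (ssnmP σ x₀) := by
    rw [ssnmP_eq_pi]; exact memLp_gaussianShiftDensity v x₀ (u l)
  have hL1 (l) : Integrable (L l) (ssnmP σ x₀) := (hL l).integrable one_le_two
  have hg1 : Integrable g (ssnmP σ x₀) := hg.integrable one_le_two
  have hintL (l) : ∫ y, L l y ∂ssnmP σ x₀ = 1 := by
    rw [ssnmP_eq_pi]; exact integral_gaussianShiftDensity hv0 x₀ (u l)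
  have hgL (l) : ∫ y, g y * L l y ∂ssnmP σ x₀ = ssnmMean σ g (x₀ + u l) := by
    rw [ssnmMean, ssnmP_eq_pi, ssnmP_eq_pi]
    exact (integral_pi_gaussianReal_add hv0 x₀ (u l) g).symm
  have hLL (l k) : ∫ y, L l y * L k y ∂ssnmP σ x₀ =
      if l = k then Real.exp (t ^ 2 / σ ^ 2) else 1 := by
    rw [ssnmP_eq_pi, integral_gaussianShiftDensity_mul hv0, hvσ]
    split_ifs with h
    · subst h
      simp [u, Pi.single_apply, sq]
    · simp [u, Pi.single_apply, Ne.symm h]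
  set m := ssnmMean σ g x₀ with hm
  have hX : MemLp (fun y => g y - m) 2 (ssnmP σ x₀) := hg.sub (memLp_const m)
  have hL' (l) : MemLp (fun y => L l y - 1) 2 (ssnmP σ x₀) := (hL l).sub (memLp_const 1)
  have hXL (l) : Integrable (fun y => (g y - m) * (L l y - 1)) (ssnmP σ x₀) :=
    hX.integrable_mul (hL' l)
  have hLL' (l k) : Integrable (fun y => (L l y - 1) * (L k y - 1)) (ssnmP σ x₀) :=
    (hL' l).integrable_mul (hL' k)
  have hcov (l) : ∫ y, (g y - m) * (L l y - 1) ∂ssnmP σ x₀ = ssnmMean σ g (x₀ + u l) - m := by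
    have e (y) : (g y - m) * (L l y - 1) = (g y * L l y - m * L l y) - (g y - m) := by ring
    have h1 : Integrable (fun y => g y * L l y) (ssnmP σ x₀) := hg.integrable_mul (hL l)
    have h2 : Integrable (fun y => g y * L l y - m * L l y) (ssnmP σ x₀) :=
      h1.sub ((hL1 l).const_mul m)
    simp_rw [e]
    rw [integral_sub h2 (hX.integrable one_le_two),
      integral_sub h1 ((hL1 l).const_mul m), integral_sub hg1 (integrable_const m),
      integral_const_mul, hintL, hgL, hm, ssnmMean, ssnmMean]
    simp
  have hLcov (l k) : ∫ y, (L l y - 1) * (L k y - 1) ∂ssnmP σ x₀ =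
      if l = k then Real.exp (t ^ 2 / σ ^ 2) - 1 else 0 := by
    have e (y) : (L l y - 1) * (L k y - 1) = (L l y * L k y - L l y) - (L k y - 1) := by ring
    have h1 : Integrable (fun y => L l y * L k y) (ssnmP σ x₀) := (hL l).integrable_mul (hL k)
    have h2 : Integrable (fun y => L l y * L k y - L l y) (ssnmP σ x₀) := h1.sub (hL1 l)
    simp_rw [e]
    rw [integral_sub h2 ((hL' k).integrable one_le_two),
      integral_sub h1 (hL1 l), integral_sub (hL1 k) (integrable_const 1), hLL, hintL, hintL]
    split_ifs <;> simp
  have hY : MemLp (fun y => ∑ l ∈ K, b l * t⁻¹ * (L l y - 1)) 2 (ssnmP σ x₀) :=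
    memLp_finsetSum _ fun l _ => (hL' l).const_mul _
  have key := two_mul_integral_mul_sub_le_integral_sq hX hY (σ ^ 2)
  have hXY : ∫ y, (g y - m) * ∑ l ∈ K, b l * t⁻¹ * (L l y - 1) ∂ssnmP σ x₀ =
      ∑ l ∈ K, b l * (t⁻¹ * (ssnmMean σ g (x₀ + u l) - m)) := by
    simp_rw [Finset.mul_sum, mul_left_comm (g _ - m)]
    rw [integral_finsetSum _ fun l _ => (hXL l).const_mul _]
    simp_rw [integral_const_mul, hcov, mul_assoc]
  have hYY : ∫ y, (∑ l ∈ K, b l * t⁻¹ * (L l y - 1)) ^ 2 ∂ssnmP σ x₀ =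
      ∑ l ∈ K, b l ^ 2 * ((t ^ 2)⁻¹ * (Real.exp (t ^ 2 / σ ^ 2) - 1)) := by
    simp_rw [sq (∑ l ∈ K, _), Finset.sum_mul_sum, mul_mul_mul_comm _ (L _ _ - 1)]
    rw [integral_finsetSum _ fun l _ => integrable_finsetSum _ fun k _ =>
      (hLL' l k).const_mul _]
    refine Finset.sum_congr rfl fun l hl => ?_
    rw [integral_finsetSum _ fun k _ => (hLL' l k).const_mul _]
    simp_rw [integral_const_mul, hLcov, mul_ite, mul_zero]
    rw [Finset.sum_ite_eq, if_pos hl]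
    ring
  rw [hXY, hYY] at key
  exact key

lemma tendsto_inv_sq_mul_exp_sub_one (c : ℝ) :
    Filter.Tendsto (fun t : ℝ => (t ^ 2)⁻¹ * (Real.exp (t ^ 2 / c) - 1))
      (nhdsWithin 0 {0}ᶜ) (nhds c⁻¹) := by
  have hd : HasDerivAt (fun s : ℝ => Real.exp (s / c)) c⁻¹ 0 := by
    simpa using ((hasDerivAt_id (0 : ℝ)).div_const c).exp
  have hsq : Filter.Tendsto (fun t : ℝ => t ^ 2) (nhdsWithin 0 {0}ᶜ) (nhdsWithin 0 {0}ᶜ) := by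
    refine tendsto_nhdsWithin_iff.2 ⟨?_, ?_⟩
    · exact ((continuous_pow 2).tendsto' (0 : ℝ) 0 (by simp)).mono_left nhdsWithin_le_nhds
    · filter_upwards [self_mem_nhdsWithin] with t ht
      exact pow_ne_zero 2 ht
  simpa [Function.comp_def] using (hasDerivAt_iff_tendsto_slope_zero.1 hd).comp hsq

/-- The Cramér–Rao bound for the parameters indexed by a finite set `K` of coordinates. -/
lemma ssnmVar_ge_sum_sq_deriv {N : ℕ} {σ : ℝ} (hσ : 0 < σ) (x₀ : Fin N → ℝ)
    {g : (Fin N → ℝ) → ℝ} (hg : MemLp g 2 (ssnmP σ x₀)) (b : Fin N → ℝ) (K : Finset (Fin N))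
    (hb : ∀ l ∈ K, HasDerivAt
      (fun t : ℝ => ssnmMean σ g (x₀ + t • (Pi.single l (1:ℝ) : Fin N → ℝ))) (b l) 0) :
    σ ^ 2 * ∑ l ∈ K, b l ^ 2 ≤ ssnmVar σ g x₀ := by
  have h1 : Filter.Tendsto (fun t : ℝ => ∑ l ∈ K, b l * (t⁻¹ *
      (ssnmMean σ g (x₀ + t • (Pi.single l (1:ℝ) : Fin N → ℝ)) - ssnmMean σ g x₀)))
      (nhdsWithin 0 {0}ᶜ) (nhds (∑ l ∈ K, b l * b l)) :=
    tendsto_finsetSum _ fun l hl => by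
      simpa using (hasDerivAt_iff_tendsto_slope_zero.1 (hb l hl)).const_mul (b l)
  have h2 : Filter.Tendsto (fun t : ℝ => ∑ l ∈ K, b l ^ 2 *
      ((t ^ 2)⁻¹ * (Real.exp (t ^ 2 / σ ^ 2) - 1)))
      (nhdsWithin 0 {0}ᶜ) (nhds (∑ l ∈ K, b l ^ 2 * (σ ^ 2)⁻¹)) :=
    tendsto_finsetSum _ fun l _ => (tendsto_inv_sq_mul_exp_sub_one (σ ^ 2)).const_mul _
  have h := le_of_tendsto' ((h1.const_mul (2 * σ ^ 2)).sub (h2.const_mul ((σ ^ 2) ^ 2)))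
    fun t => ssnmVar_ge_finite_difference hσ x₀ hg b K t
  refine le_trans (le_of_eq ?_) h
  rw [← Finset.sum_mul]
  simp_rw [← sq]
  field_simp
  ring

/-- Sparse CRB for the SSNM. (a) If `|supp(x₀)| < S` and the mean
function of a finite-variance estimator `ĝ` has partial derivatives `b_l` at `x₀` along
all directions, then `v(ĝ;x₀) ≥ σ² Σ_{l=1}^N b_l²`. (b) If `|supp(x₀)| = S` (support
given as the finset `K`) and the partial derivatives `b_l` exist for `l ∈ supp(x₀)`,
then `v(ĝ;x₀) ≥ σ² Σ_{l∈supp(x₀)} b_l²`. -/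
theorem ssnm_sparse_crb {N S : ℕ} (hN : 1 ≤ N) (hS1 : 1 ≤ S) (hSN : S ≤ N)
    (σ : ℝ) (hσ : 0 < σ)
    (x₀ : Fin N → ℝ) (hx₀ : x₀ ∈ sparseSet N S)
    (g : (Fin N → ℝ) → ℝ) (hg : Measurable g)
    (hint : ∀ x ∈ sparseSet N S, Integrable g (ssnmP σ x))
    (hsq : Integrable (fun y => g y ^ 2) (ssnmP σ x₀))
    (b : Fin N → ℝ) :
    ((Function.support x₀).ncard < S →
      (∀ l : Fin N, HasDerivAt
        (fun t : ℝ => ssnmMean σ g (x₀ + t • (Pi.single l (1:ℝ) : Fin N → ℝ))) (b l) 0) →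
      σ ^ 2 * ∑ l, b l ^ 2 ≤ ssnmVar σ g x₀)
    ∧
    (∀ K : Finset (Fin N), (∀ l, l ∈ K ↔ x₀ l ≠ 0) → (Function.support x₀).ncard = S →
      (∀ l ∈ K, HasDerivAt
        (fun t : ℝ => ssnmMean σ g (x₀ + t • (Pi.single l (1:ℝ) : Fin N → ℝ))) (b l) 0) →
      σ ^ 2 * ∑ l ∈ K, b l ^ 2 ≤ ssnmVar σ g x₀) := by
  have hg2 : MemLp g 2 (ssnmP σ x₀) :=
    (memLp_two_iff_integrable_sq hg.aestronglyMeasurable).2 hsq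
  exact ⟨fun _ hb => ssnmVar_ge_sum_sq_deriv hσ x₀ hg2 b Finset.univ fun l _ => hb l,
    fun K _ _ hb => ssnmVar_ge_sum_sq_deriv hσ x₀ hg2 b K hb⟩
end
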